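/- arXiv:1307.6110 — 6 statements merged into one kernel-verified Lean document; each statement's English description precedes it below -/
import Mathlib

section
/- (Lemma 4.2, positivity of the dual variable θ.) Assume h ≠ 0 and, for every k = 1,…,K, the pair {h, g_k} is linearly independent in ℂ^M. Let λ > 0, β_k ≥ 0 and α_k ≥ 0 for all k, and θ ≥ 0. If A₁ ⪯ 0 and B₁ ⪯ 0, then θ > 0. -/
open Matrix Finset
open scoped ComplexOrder

theorem star_dotProduct_vecMulVec_mulVec {n : Type*} [Fintype n] (v x : n → ℂ) :
    star x ⬝ᵥ (vecMulVec v (star v) *ᵥ x) = (Complex.normSq (star v ⬝ᵥ x) : ℂ) := by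
  rw [vecMulVec_mulVec, op_smul_eq_smul, dotProduct_smul, smul_eq_mul, Complex.normSq_eq_conj_mul_self,
    mul_comm, starRingEnd_apply, ← star_dotProduct_star, star_star, dotProduct_comm (star x)]

/-- Two linearly independent vectors admit a vector orthogonal to the first but not the second. -/
theorem exists_orthogonal_of_linearIndependent {n : Type*} [Fintype n] {v w : n → ℂ}
    (hvw : LinearIndependent ℂ ![v, w]) :
    ∃ x : n → ℂ, star v ⬝ᵥ x = 0 ∧ star w ⬝ᵥ x ≠ 0 := by
  have hpair := LinearIndependent.pair_iff.mp hvw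
  have hv : star v ⬝ᵥ v ≠ 0 := by
    rw [Ne, dotProduct_star_self_eq_zero]
    rintro rfl
    simpa using hpair 1 0 (by simp)
  have horth : star v ⬝ᵥ ((star v ⬝ᵥ v) • w - (star v ⬝ᵥ w) • v) = 0 := by
    simp only [dotProduct_sub, dotProduct_smul, smul_eq_mul]
    ring
  refine ⟨(star v ⬝ᵥ v) • w - (star v ⬝ᵥ w) • v, horth, fun hw => ?_⟩
  have hx : (star v ⬝ᵥ v) • w - (star v ⬝ᵥ w) • v = 0 := by
    rw [← dotProduct_star_self_eq_zero]
    nth_rewrite 1 [star_sub, star_smul, star_smul]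
    rw [sub_dotProduct, smul_dotProduct, smul_dotProduct, horth, hw]
    simp
  refine hv (hpair (-(star v ⬝ᵥ w)) (star v ⬝ᵥ v) ?_).2
  rw [← hx, neg_smul]
  abel

/-- Lemma 4.2: if λ > 0, β, α ≥ 0, θ ≥ 0 and both A₁ ⪯ 0 and
B₁ ⪯ 0, with h ≠ 0 and {h, g_k} linearly independent for each k, then θ > 0. -/
theorem stmt_3 (M K : ℕ) (hM : 1 ≤ M) (hK : 1 ≤ K)
    (h : Fin M → ℂ) (g : Fin K → Fin M → ℂ)
    (hh : h ≠ 0) (hind : ∀ k, LinearIndependent ℂ ![h, g k])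
    (γe ζ : ℝ) (hγe : 0 < γe) (hζ0 : 0 < ζ) (hζ1 : ζ ≤ 1)
    (lam θ : ℝ) (β α : Fin K → ℝ)
    (hlam : 0 < lam) (hβ : ∀ k, 0 ≤ β k) (hα : ∀ k, 0 ≤ α k) (hθ : 0 ≤ θ)
    (A1 B1 : Matrix (Fin M) (Fin M) ℂ)
    (hA1 : A1 = vecMulVec h (star h)
      - ∑ k, (β k : ℂ) • vecMulVec (g k) (star (g k))
      + ∑ k, ((α k * ζ : ℝ) : ℂ) • vecMulVec (g k) (star (g k))
      - (θ : ℂ) • (1 : Matrix (Fin M) (Fin M) ℂ))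
    (hB1 : B1 = -((lam : ℂ) • vecMulVec h (star h))
      + ∑ k, ((β k * γe : ℝ) : ℂ) • vecMulVec (g k) (star (g k))
      + ∑ k, ((α k * ζ : ℝ) : ℂ) • vecMulVec (g k) (star (g k))
      - (θ : ℂ) • (1 : Matrix (Fin M) (Fin M) ℂ))
    (hA1nsd : (-A1).PosSemidef) (hB1nsd : (-B1).PosSemidef) :
    0 < θ := by
  refine hθ.lt_of_ne fun h0 => ?_
  subst h0
  have hcoef : ∀ k, 0 ≤ β k * γe + α k * ζ := fun k =>
    add_nonneg (mul_nonneg (hβ k) hγe.le) (mul_nonneg (hα k) hζ0.le)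
  have hzero : ∀ k, β k = 0 ∧ α k = 0 := by
    intro k
    obtain ⟨x, hhx, hgx⟩ := exists_orthogonal_of_linearIndependent (hind k)
    have hB := hB1nsd.dotProduct_mulVec_nonneg x
    simp only [hB1, neg_mulVec, sub_mulVec, add_mulVec, sum_mulVec, smul_mulVec, dotProduct_neg,
      dotProduct_sub, dotProduct_add, dotProduct_sum, dotProduct_smul, smul_eq_mul,
      star_dotProduct_vecMulVec_mulVec, hhx] at hB
    have hsum : ∑ j, (β j * γe + α j * ζ) * Complex.normSq (star (g j) ⬝ᵥ x) ≤ 0 := by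
      have hre : 0 ≤ -∑ j, (β j * γe + α j * ζ) * Complex.normSq (star (g j) ⬝ᵥ x) := by
        rw [← Complex.zero_le_real]
        convert hB using 1
        push_cast
        simp [add_mul, sum_add_distrib]
      linarith
    have hterm := (Finset.single_le_sum (f := fun j =>
      (β j * γe + α j * ζ) * Complex.normSq (star (g j) ⬝ᵥ x))
      (fun j _ => mul_nonneg (hcoef j) (Complex.normSq_nonneg _)) (mem_univ k)).trans hsum
    have hle := nonpos_of_mul_nonpos_left hterm (Complex.normSq_pos.mpr hgx)
    have h1 := mul_nonneg (hβ k) hγe.le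
    have h2 := mul_nonneg (hα k) hζ0.le
    exact ⟨(mul_eq_zero.mp (by linarith : β k * γe = 0)).resolve_right hγe.ne',
      (mul_eq_zero.mp (by linarith : α k * ζ = 0)).resolve_right hζ0.ne'⟩
  have hA := hA1nsd.dotProduct_mulVec_nonneg h
  have hpos : 0 < Complex.normSq (star h ⬝ᵥ h) := by
    rwa [Complex.normSq_pos, Ne, dotProduct_star_self_eq_zero]
  have hA1h : A1 = vecMulVec h (star h) := by
    simp [hA1, hzero]
  rw [hA1h, neg_mulVec, dotProduct_neg, star_dotProduct_vecMulVec_mulVec, ← Complex.ofReal_neg,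
    Complex.zero_le_real] at hA
  linarith
end

section
/- (Proposition 4.1, part 1.) Let λ > 0, θ > 0, and β_k ≥ 0, α_k ≥ 0 for all k. Then rank(B₁) ≥ M − K, and consequently every M×M complex matrix Q satisfying B₁ Q = 0 has rank(Q) ≤ min(K, M). -/
open Matrix Finset
open scoped ComplexOrder

/-- The rank of a difference is at most the sum of the ranks. -/
theorem rank_sub_le_rank_add_rank {m n F : Type*} [Field F] [Fintype m] [Fintype n]
    (A B : Matrix m n F) : (A - B).rank ≤ A.rank + B.rank := by
  classical
  unfold Matrix.rank
  refine le_trans (Submodule.finrank_mono ?_)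
    (Submodule.finrank_add_le_finrank_add_finrank (LinearMap.range A.mulVecLin)
      (LinearMap.range B.mulVecLin))
  rintro _ ⟨x, rfl⟩
  rw [mulVecLin_apply, sub_mulVec, sub_eq_add_neg]
  exact Submodule.add_mem_sup ⟨x, rfl⟩ (Submodule.neg_mem _ ⟨x, rfl⟩)

/-- A linear combination of `K` rank-one matrices has rank at most `K`. -/
theorem rank_sum_smul_vecMulVec_le {m n F : Type*} [Field F] [Fintype m] [Fintype n] {K : ℕ}
    (c : Fin K → F) (u : Fin K → m → F) (v : Fin K → n → F) :
    (∑ k, c k • vecMulVec (u k) (v k)).rank ≤ K := by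
  have hfac : ∑ k, c k • vecMulVec (u k) (v k) =
      (of fun i k => c k * u k i) * (of fun k j => v k j) := by
    ext i j
    simp [Matrix.sum_apply, mul_apply, vecMulVec_apply, mul_assoc]
  rw [hfac]
  refine (rank_mul_le_left _ _).trans ((rank_le_card_width _).trans ?_)
  simp

/-- A nonnegative multiple of `h hᴴ` plus a positive multiple of the identity has full rank. -/
theorem rank_smul_vecMulVec_star_add_smul_one {m : Type*} [Fintype m] [DecidableEq m]
    (h : m → ℂ) {a b : ℝ} (ha : 0 ≤ a) (hb : 0 < b) :
    ((a : ℂ) • vecMulVec h (star h) + (b : ℂ) • (1 : Matrix m m ℂ)).rank = Fintype.card m := by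
  refine rank_of_isUnit _ (PosDef.isUnit ?_)
  refine PosDef.posSemidef_add ?_ ?_
  · exact (posSemidef_vecMulVec_self_star h).smul (by exact_mod_cast ha)
  · exact PosDef.one.smul (by exact_mod_cast hb)

/-- Proposition 4.1, part 1: if λ > 0, θ > 0, β, α ≥ 0, then
rank(B₁) ≥ M − K, and every M×M matrix Q with B₁ Q = 0 satisfies
rank(Q) ≤ min(K, M). -/
theorem stmt_4 (M K : ℕ) (hM : 1 ≤ M) (hK : 1 ≤ K)
    (h : Fin M → ℂ) (g : Fin K → Fin M → ℂ)
    (γe ζ : ℝ) (hγe : 0 < γe) (hζ0 : 0 < ζ) (hζ1 : ζ ≤ 1)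
    (lam θ : ℝ) (β α : Fin K → ℝ)
    (hlam : 0 < lam) (hθ : 0 < θ) (hβ : ∀ k, 0 ≤ β k) (hα : ∀ k, 0 ≤ α k)
    (B1 : Matrix (Fin M) (Fin M) ℂ)
    (hB1 : B1 = -((lam : ℂ) • vecMulVec h (star h))
      + ∑ k, ((β k * γe : ℝ) : ℂ) • vecMulVec (g k) (star (g k))
      + ∑ k, ((α k * ζ : ℝ) : ℂ) • vecMulVec (g k) (star (g k))
      - (θ : ℂ) • (1 : Matrix (Fin M) (Fin M) ℂ)) :
    M - K ≤ B1.rank ∧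
    ∀ Q : Matrix (Fin M) (Fin M) ℂ, B1 * Q = 0 → Q.rank ≤ min K M := by
  have hrank : M ≤ K + B1.rank := by
    have hdecomp : (lam : ℂ) • vecMulVec h (star h) + (θ : ℂ) • (1 : Matrix (Fin M) (Fin M) ℂ) =
        (∑ k, ((β k * γe + α k * ζ : ℝ) : ℂ) • vecMulVec (g k) (star (g k))) - B1 := by
      simp only [hB1, Complex.ofReal_add, add_smul, Finset.sum_add_distrib]
      abel
    calc M = ((lam : ℂ) • vecMulVec h (star h)
          + (θ : ℂ) • (1 : Matrix (Fin M) (Fin M) ℂ)).rank := by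
          rw [rank_smul_vecMulVec_star_add_smul_one h hlam.le hθ, Fintype.card_fin]
      _ ≤ _ := by
          rw [hdecomp]
          exact (rank_sub_le_rank_add_rank _ _).trans
            (Nat.add_le_add_right (rank_sum_smul_vecMulVec_le _ _ _) _)
  refine ⟨by lia, fun Q hQ => ?_⟩
  have hsum := rank_add_rank_le_card_of_mul_eq_zero hQ
  rw [Fintype.card_fin] at hsum
  exact le_min (by lia) (by lia)
end

section
/- (Proposition 4.1, part 3 — rank-one reconstruction.) Suppose (S, Q, t) is feasible for problem (P1.1-SDR-Eqv), and suppose S admits the decomposition S = Σ_{n=1}^{m} a_n π_n π_nᴴ + b τ τᴴ, where a_n ≥ 0 for all n, b ≥ 0, the vectors π_1,…,π_m ∈ ℂ^M satisfy hᴴ π_n = 0 for every n, and τ ∈ ℂ^M. Define S̄ = b τ τᴴ and Q̄ = Q + Σ_{n=1}^{m} a_n π_n π_nᴴ. Then (S̄, Q̄, t) is also feasible for (P1.1-SDR-Eqv), Tr(H S̄) = Tr(H S) (the objective value is unchanged), and rank(S̄) ≤ 1. In particular, if (S, Q, t) is optimal for (P1.1-SDR-Eqv), then so is (S̄, Q̄,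 t). -/
open Matrix Finset
open scoped ComplexOrder

/-- Feasibility for problem (P1.1-SDR-Eqv). -/
def P11EqvFeasible (M K : ℕ) (h : Fin M → ℂ) (g : Fin K → Fin M → ℂ)
    (σ0 : ℝ) (σ : Fin K → ℝ) (ζ γe P : ℝ) (E : Fin K → ℝ)
    (S Q : Matrix (Fin M) (Fin M) ℂ) (t : ℝ) : Prop :=
  S.PosSemidef ∧ Q.PosSemidef ∧ 0 < t ∧
  ((vecMulVec h (star h)) * Q).trace.re + t * σ0 = 1 ∧
  (∀ k, ((vecMulVec (g k) (star (g k))) * S).trace.re ≤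
      γe * (((vecMulVec (g k) (star (g k))) * Q).trace.re + t * σ k)) ∧
  (∀ k, ζ * (((vecMulVec (g k) (star (g k))) * S).trace.re +
      ((vecMulVec (g k) (star (g k))) * Q).trace.re) ≥ t * E k) ∧
  S.trace.re + Q.trace.re ≤ t * P

/-- The quadratic form of a positive semidefinite matrix, written as a trace against a rank-one
outer product, is nonnegative. -/
lemma Matrix.PosSemidef.re_trace_vecMulVec_mul_nonneg {n : Type*} [Fintype n]
    {A : Matrix n n ℂ} (hA : A.PosSemidef) (x : n → ℂ) :
    0 ≤ (vecMulVec x (star x) * A).trace.re := by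
  rw [trace_mul_comm, mul_vecMulVec, trace_vecMulVec, dotProduct_comm]
  exact hA.re_dotProduct_nonneg x

/-- The trace against `vecMulVec x y` vanishes on every combination of outer products whose left
factors are annihilated by `y`. -/
lemma Matrix.trace_vecMulVec_mul_sum_eq_zero {n ι : Type*} [Fintype n] [Fintype ι]
    (x y : n → ℂ) (c : ι → ℂ) (v w : ι → n → ℂ) (hv : ∀ i, y ⬝ᵥ v i = 0) :
    (vecMulVec x y * ∑ i, c i • vecMulVec (v i) (w i)).trace = 0 := by
  simp [Matrix.mul_sum, vecMulVec_mul_vecMulVec, hv]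

lemma Matrix.posSemidef_ofReal_smul_vecMulVec_self_star {n : Type*} [Fintype n]
    {c : ℝ} (hc : 0 ≤ c) (x : n → ℂ) :
    ((c : ℂ) • vecMulVec x (star x)).PosSemidef :=
  (posSemidef_vecMulVec_self_star x).smul (by exact_mod_cast hc)

/-- Proposition 4.1, part 3 — rank-one reconstruction: if (S, Q, t)
is feasible for (P1.1-SDR-Eqv) and S = Σ aₙ πₙ πₙᴴ + b τ τᴴ with aₙ, b ≥ 0 and
hᴴ πₙ = 0, then (S̄, Q̄, t) with S̄ = b τ τᴴ, Q̄ = Q + Σ aₙ πₙ πₙᴴ is also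
feasible, the objective is unchanged, rank(S̄) ≤ 1, and optimality is preserved. -/
theorem stmt_6 (M K m : ℕ) (hM : 1 ≤ M) (hK : 1 ≤ K)
    (h : Fin M → ℂ) (g : Fin K → Fin M → ℂ)
    (σ0 : ℝ) (hσ0 : 0 < σ0) (σ : Fin K → ℝ) (hσ : ∀ k, 0 < σ k)
    (ζ : ℝ) (hζ0 : 0 < ζ) (hζ1 : ζ ≤ 1)
    (γe : ℝ) (hγe : 0 < γe) (P : ℝ) (hP : 0 < P)
    (E : Fin K → ℝ) (hE : ∀ k, 0 ≤ E k)
    (S Q : Matrix (Fin M) (Fin M) ℂ) (t : ℝ)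
    (hfeas : P11EqvFeasible M K h g σ0 σ ζ γe P E S Q t)
    (a : Fin m → ℝ) (ha : ∀ n, 0 ≤ a n) (b : ℝ) (hb : 0 ≤ b)
    (π : Fin m → Fin M → ℂ) (hπ : ∀ n, star h ⬝ᵥ π n = 0)
    (τ : Fin M → ℂ)
    (hSdec : S = ∑ n, (a n : ℂ) • vecMulVec (π n) (star (π n))
      + (b : ℂ) • vecMulVec τ (star τ))
    (Sb Qb : Matrix (Fin M) (Fin M) ℂ)
    (hSb : Sb = (b : ℂ) • vecMulVec τ (star τ))
    (hQb : Qb = Q + ∑ n, (a n : ℂ) • vecMulVec (π n) (star (π n))) :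
    P11EqvFeasible M K h g σ0 σ ζ γe P E Sb Qb t ∧
    ((vecMulVec h (star h)) * Sb).trace.re = ((vecMulVec h (star h)) * S).trace.re ∧
    Sb.rank ≤ 1 ∧
    ((∀ S' Q' t', P11EqvFeasible M K h g σ0 σ ζ γe P E S' Q' t' →
        ((vecMulVec h (star h)) * S').trace.re ≤ ((vecMulVec h (star h)) * S).trace.re) →
      (∀ S' Q' t', P11EqvFeasible M K h g σ0 σ ζ γe P E S' Q' t' →
        ((vecMulVec h (star h)) * S').trace.re ≤ ((vecMulVec h (star h)) * Sb).trace.re)) := by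
  obtain ⟨-, hQ, ht, hnorm, hsinr, henergy, hpower⟩ := hfeas
  set R := ∑ n, (a n : ℂ) • vecMulVec (π n) (star (π n))
  have hRpsd : R.PosSemidef := posSemidef_sum _ fun n _ =>
    posSemidef_ofReal_smul_vecMulVec_self_star (ha n) (π n)
  have hRzero : (vecMulVec h (star h) * R).trace = 0 :=
    trace_vecMulVec_mul_sum_eq_zero h (star h) _ π _ hπ
  have hSR : S = R + Sb := by rw [hSdec, hSb]
  have hobj : (vecMulVec h (star h) * Sb).trace.re = (vecMulVec h (star h) * S).trace.re := by
    simp [hSR, Matrix.mul_add, hRzero]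
  have hSbpsd : Sb.PosSemidef := hSb ▸ posSemidef_ofReal_smul_vecMulVec_self_star hb τ
  refine ⟨⟨hSbpsd, hQb ▸ hQ.add hRpsd, ht, ?_, fun k => ?_, fun k => ?_, ?_⟩, hobj, ?_, ?_⟩
  · simpa [hQb, Matrix.mul_add, hRzero] using hnorm
  · have hk := hsinr k
    have hRk := hRpsd.re_trace_vecMulVec_mul_nonneg (g k)
    simp only [hSR, hQb, Matrix.mul_add, trace_add, Complex.add_re] at hk ⊢
    nlinarith [mul_nonneg hγe.le hRk]
  · have hk := henergy k
    simp only [hSR, hQb, Matrix.mul_add, trace_add, Complex.add_re] at hk ⊢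
    linarith
  · simp only [hSR, hQb, trace_add, Complex.add_re] at hpower ⊢
    linarith
  · rw [hSb, ← smul_vecMulVec]
    exact rank_vecMulVec_le _ _
  · intro hopt S' Q' t' hf
    exact hobj ▸ hopt S' Q' t' hf
end

section
/- (Corollary 4.2.) Let λ > 0, θ > 0, β_k ≥ 0 and α_k ≥ 0 for all k, and suppose A₁ ⪯ 0 and B₁ ⪯ 0. Let Ψ̄ = {k : β_k > 0}. If the collection of vectors {h} ∪ {g_k : k ∈ Ψ̄} spans ℂ^M (equivalently, the matrix whose rows are hᴴ and g_kᴴ for k ∈ Ψ̄ has rank M; this holds in particular when |Ψ̄| ≥ M − 1 and every M-element subset of {h, g_1, …, g_K} is linearly independent), then D₁ is negative definite, and every positive semidefinite M×M matrix S satisfying A₁ S = 0 has rank(S) ≤ 1. -/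
open Matrix Finset
open scoped ComplexOrder

/-- If the quadratic form of a positive semidefinite matrix plus a positive multiple of `v vᴴ`
vanishes at `x`, then `x` is orthogonal to `v`. -/
theorem dotProduct_eq_zero_of_posSemidef_add_smul_vecMulVec {n : Type*} [Fintype n]
    {P : Matrix n n ℂ} (hP : P.PosSemidef) {c : ℝ} (hc : 0 < c) {v x : n → ℂ}
    (hx : star x ⬝ᵥ ((P + (c : ℂ) • vecMulVec v (star v)) *ᵥ x) = 0) :
    star x ⬝ᵥ v = 0 := by
  have hstar : star v ⬝ᵥ x = star (star x ⬝ᵥ v) :=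
    star_dotProduct v x
  have hform : star x ⬝ᵥ (((c : ℂ) • vecMulVec v (star v)) *ᵥ x) =
      (c : ℂ) * ((star x ⬝ᵥ v) * star (star x ⬝ᵥ v)) := by
    rw [smul_mulVec, dotProduct_smul, vecMulVec_mulVec, hstar, op_smul_eq_smul, dotProduct_smul,
      smul_eq_mul, smul_eq_mul, mul_comm (star x ⬝ᵥ v)]
  have hc' : (0 : ℂ) < c := by exact_mod_cast hc
  have hsq : (0 : ℂ) ≤ (c : ℂ) * ((star x ⬝ᵥ v) * star (star x ⬝ᵥ v)) :=
    mul_nonneg hc'.le (mul_star_self_nonneg _)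
  rw [add_mulVec, dotProduct_add, hform,
    add_eq_zero_iff_of_nonneg (hP.dotProduct_mulVec_nonneg x) hsq] at hx
  simpa [hc.ne'] using hx.2

/-- A vector orthogonal to a spanning set of `ℂⁿ` is zero. -/
theorem eq_zero_of_dotProduct_eq_zero_of_span_eq_top {n : Type*} [Fintype n]
    {s : Set (n → ℂ)} (hs : Submodule.span ℂ s = ⊤) {x : n → ℂ}
    (hx : ∀ v ∈ s, star x ⬝ᵥ v = 0) : x = 0 := by
  have key : ∀ v ∈ Submodule.span ℂ s, star x ⬝ᵥ v = 0 := by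
    intro v hv
    induction hv using Submodule.span_induction with
    | mem v hv => exact hx v hv
    | zero => simp
    | add u w _ _ hu hw => rw [dotProduct_add, hu, hw, add_zero]
    | smul a u _ hu => rw [dotProduct_smul, hu, smul_zero]
  exact dotProduct_star_self_eq_zero.1 (key x (hs ▸ Submodule.mem_top))

/-- Corollary 4.2: under the dual conditions, if the vectors
{h} ∪ {g_k : β_k > 0} span ℂ^M, then D₁ is negative definite, and every PSD S
with A₁ S = 0 has rank(S) ≤ 1. -/
theorem stmt_9 (M K : ℕ) (hM : 1 ≤ M) (hK : 1 ≤ K)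
    (h : Fin M → ℂ) (g : Fin K → Fin M → ℂ)
    (γe ζ : ℝ) (hγe : 0 < γe) (hζ0 : 0 < ζ) (hζ1 : ζ ≤ 1)
    (lam θ : ℝ) (β α : Fin K → ℝ)
    (hlam : 0 < lam) (hθ : 0 < θ) (hβ : ∀ k, 0 ≤ β k) (hα : ∀ k, 0 ≤ α k)
    (A1 B1 D1 : Matrix (Fin M) (Fin M) ℂ)
    (hA1 : A1 = vecMulVec h (star h)
      - ∑ k, (β k : ℂ) • vecMulVec (g k) (star (g k))
      + ∑ k, ((α k * ζ : ℝ) : ℂ) • vecMulVec (g k) (star (g k))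
      - (θ : ℂ) • (1 : Matrix (Fin M) (Fin M) ℂ))
    (hB1 : B1 = -((lam : ℂ) • vecMulVec h (star h))
      + ∑ k, ((β k * γe : ℝ) : ℂ) • vecMulVec (g k) (star (g k))
      + ∑ k, ((α k * ζ : ℝ) : ℂ) • vecMulVec (g k) (star (g k))
      - (θ : ℂ) • (1 : Matrix (Fin M) (Fin M) ℂ))
    (hD1 : D1 = -((lam : ℂ) • vecMulVec h (star h))
      - ∑ k, (β k : ℂ) • vecMulVec (g k) (star (g k))
      + ∑ k, ((α k * ζ : ℝ) : ℂ) • vecMulVec (g k) (star (g k))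
      - (θ : ℂ) • (1 : Matrix (Fin M) (Fin M) ℂ))
    (hA1nsd : (-A1).PosSemidef) (hB1nsd : (-B1).PosSemidef)
    (hspan : Submodule.span ℂ ({h} ∪ (g '' {k | 0 < β k})) = ⊤) :
    (-D1).PosDef ∧
    ∀ S : Matrix (Fin M) (Fin M) ℂ, S.PosSemidef → A1 * S = 0 → S.rank ≤ 1 := by
  have hDA : -D1 = -A1 + ((1 + lam : ℝ) : ℂ) • vecMulVec h (star h) := by
    rw [hA1, hD1]
    push_cast
    module
  have hDB : -D1 = -B1 + ∑ k, (((1 + γe) * β k : ℝ) : ℂ) • vecMulVec (g k) (star (g k)) := by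
    have hsum : ∑ k, (((1 + γe) * β k : ℝ) : ℂ) • vecMulVec (g k) (star (g k)) =
        ∑ k, (β k : ℂ) • vecMulVec (g k) (star (g k)) +
          ∑ k, ((β k * γe : ℝ) : ℂ) • vecMulVec (g k) (star (g k)) := by
      rw [← sum_add_distrib]
      refine sum_congr rfl fun k _ => ?_
      push_cast
      module
    rw [hsum, hB1, hD1]
    abel
  have hterm : ∀ k, ((((1 + γe) * β k : ℝ) : ℂ) • vecMulVec (g k) (star (g k))).PosSemidef :=
    fun k => (posSemidef_vecMulVec_self_star (g k)).smul
      (by exact_mod_cast mul_nonneg (by linarith) (hβ k))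
  have hDpsd : (-D1).PosSemidef := hDB ▸ hB1nsd.add (posSemidef_sum _ fun k _ => hterm k)
  have hDpos : (-D1).PosDef := by
    refine .of_dotProduct_mulVec_pos hDpsd.isHermitian fun x hx => ?_
    refine lt_of_le_of_ne (hDpsd.dotProduct_mulVec_nonneg x) fun h0 => hx ?_
    refine eq_zero_of_dotProduct_eq_zero_of_span_eq_top hspan ?_
    rintro v (rfl | ⟨k, hk, rfl⟩)
    · exact dotProduct_eq_zero_of_posSemidef_add_smul_vecMulVec hA1nsd
        (by linarith : 0 < 1 + lam) (hDA ▸ h0.symm)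
    · refine dotProduct_eq_zero_of_posSemidef_add_smul_vecMulVec
        (hB1nsd.add (posSemidef_sum (univ.erase k) fun j _ => hterm j))
        (mul_pos (by linarith) hk : 0 < (1 + γe) * β k) ?_
      rw [add_assoc, sum_erase_add _ _ (mem_univ k), ← hDB]
      exact h0.symm
  refine ⟨hDpos, fun S _ hAS => ?_⟩
  have hDS : -D1 * S =
      vecMulVec (((1 + lam : ℝ) : ℂ) • h) (star h) * S := by
    rw [hDA, add_mul, neg_mul, hAS, neg_zero, zero_add, smul_vecMulVec]
  calc S.rank = (-D1 * S).rank :=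
        (rank_mul_eq_right_of_isUnit_det _ _ ((isUnit_iff_isUnit_det _).1 hDpos.isUnit)).symm
    _ ≤ (vecMulVec (((1 + lam : ℝ) : ℂ) • h) (star h)).rank := hDS ▸ rank_mul_le_left _ _
    _ ≤ 1 := rank_vecMulVec_le _ _
end

section
/- (Two-stage reformulation of problem (P1).) Assume the feasible set F of problem (P1) is nonempty. For γ_e > 0, let g₁(γ_e) denote the supremum of SINR₀(v₀, w_1,…,w_d) over all (v₀, w_1,…,w_d) ∈ F that additionally satisfy SINR_k(v₀, w_1,…,w_d) ≤ γ_e for every k = 1,…,K (the supremum of the empty set being taken as −∞). Then the optimal value of (P1), i.e., the supremum of r₀(v₀, w_1,…,w_d) over F, equals sup_{γ_e > 0} log₂((1 + g₁(γ_e)) / (1 + γ_e)). -/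
open Matrix Finset
open scoped ComplexOrder

/-- Maximizing `min_k log₂ ((1 + a) / (1 + b k))` over a set on which `a` is bounded amounts to first
maximizing `a` under the constraints `b k ≤ γ`, and then maximizing over the level `γ > 0`. -/
theorem sSup_iInf_logb_sub_eq_sSup_level {X ι : Type*} [Finite ι] [Nonempty ι] (F : X → Prop)
    (a : X → ℝ) (b : ι → X → ℝ) (ha : ∀ x, 0 ≤ a x) (hb : ∀ k x, 0 ≤ b k x)
    (B : ℝ) (hB : ∀ x, F x → a x ≤ B) (hne : ∃ x, F x) :
    sSup {r : ℝ | ∃ x, F x ∧ r = ⨅ k, (Real.logb 2 (1 + a x) - Real.logb 2 (1 + b k x))} =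
    sSup {r : ℝ | ∃ γ : ℝ, 0 < γ ∧ (∃ x, F x ∧ ∀ k, b k x ≤ γ) ∧
      r = Real.logb 2 ((1 + sSup {s : ℝ | ∃ x, F x ∧ (∀ k, b k x ≤ γ) ∧ s = a x}) / (1 + γ))} := by
  set L := sSup {r : ℝ | ∃ x, F x ∧
    r = ⨅ k, (Real.logb 2 (1 + a x) - Real.logb 2 (1 + b k x))} with hL
  have hle : ∀ x, F x → (⨅ k, (Real.logb 2 (1 + a x) - Real.logb 2 (1 + b k x))) ≤ L := by
    intro x hx
    refine le_csSup ⟨Real.logb 2 (1 + B), ?_⟩ ⟨x, hx, rfl⟩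
    rintro _ ⟨y, hy, rfl⟩
    obtain ⟨k⟩ := ‹Nonempty ι›
    refine (ciInf_le (Set.finite_range _).bddBelow k).trans ?_
    have h1 : Real.logb 2 (1 + a y) ≤ Real.logb 2 (1 + B) :=
      Real.logb_le_logb_of_le one_lt_two (by linarith [ha y]) (by linarith [hB y hy])
    have h2 : 0 ≤ Real.logb 2 (1 + b k y) :=
      Real.logb_nonneg one_lt_two (by linarith [hb k y])
    linarith
  have hbdd : ∀ γ, BddAbove {s : ℝ | ∃ x, F x ∧ (∀ k, b k x ≤ γ) ∧ s = a x} := by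
    rintro γ
    refine ⟨B, ?_⟩
    rintro _ ⟨y, hy, -, rfl⟩
    exact hB y hy
  have hlevel : ∀ x γ, F x → 0 < γ → (∀ k, b k x ≤ γ) →
      0 ≤ sSup {s : ℝ | ∃ x, F x ∧ (∀ k, b k x ≤ γ) ∧ s = a x} ∧
      Real.logb 2 (1 + a x) - Real.logb 2 (1 + γ) ≤
      Real.logb 2 ((1 + sSup {s : ℝ | ∃ x, F x ∧ (∀ k, b k x ≤ γ) ∧ s = a x}) / (1 + γ)) := by
    intro x γ hx hγ hxγ
    have h1 : a x ≤ sSup {s : ℝ | ∃ x, F x ∧ (∀ k, b k x ≤ γ) ∧ s = a x} :=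
      le_csSup (hbdd γ) ⟨x, hx, hxγ, rfl⟩
    have h0 := ha x
    refine ⟨h0.trans h1, ?_⟩
    rw [Real.logb_div (by linarith) (by linarith)]
    gcongr
    exact one_lt_two
  have hupper : ∀ r ∈ {r : ℝ | ∃ γ : ℝ, 0 < γ ∧ (∃ x, F x ∧ ∀ k, b k x ≤ γ) ∧
      r = Real.logb 2
        ((1 + sSup {s : ℝ | ∃ x, F x ∧ (∀ k, b k x ≤ γ) ∧ s = a x}) / (1 + γ))}, r ≤ L := by
    rintro _ ⟨γ, hγ, ⟨x, hx, hxγ⟩, rfl⟩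
    have h0 := (hlevel x γ hx hγ hxγ).1
    rw [Real.logb_le_iff_le_rpow one_lt_two (by positivity), div_le_iff₀ (by positivity),
      ← le_sub_iff_add_le']
    refine csSup_le ⟨_, x, hx, hxγ, rfl⟩ ?_
    rintro _ ⟨y, hy, hyγ, rfl⟩
    have hay := ha y
    rw [le_sub_iff_add_le', ← div_le_iff₀ (by positivity),
      ← Real.logb_le_iff_le_rpow one_lt_two (by positivity),
      Real.logb_div (by positivity) (by positivity)]
    refine le_trans (le_ciInf fun k => ?_) (hle y hy)
    have hbk := hb k y
    gcongr
    · exact one_lt_two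
    · exact hyγ k
  apply le_antisymm
  · obtain ⟨x₀, hx₀⟩ := hne
    refine csSup_le ⟨_, x₀, hx₀, rfl⟩ ?_
    rintro _ ⟨x, hx, rfl⟩
    obtain ⟨k, hk⟩ := Finite.exists_max fun k => b k x
    refine (ciInf_le (Set.finite_range _).bddBelow k).trans ?_
    have hbk := hb k x
    have hcont : Filter.Tendsto (fun γ => Real.logb 2 (1 + a x) - Real.logb 2 (1 + γ))
        (nhdsWithin (b k x) (Set.Ioi (b k x)))
        (nhds (Real.logb 2 (1 + a x) - Real.logb 2 (1 + b k x))) := by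
      have : ContinuousAt (fun γ => Real.logb 2 (1 + a x) - Real.logb 2 (1 + γ)) (b k x) := by
        unfold Real.logb
        have : 1 + b k x ≠ 0 := by positivity
        fun_prop (disch := assumption)
      exact this.tendsto.mono_left nhdsWithin_le_nhds
    refine le_of_tendsto hcont ?_
    filter_upwards [self_mem_nhdsWithin] with γ hγ
    have hγ' : b k x < γ := hγ
    have hxγ : ∀ j, b j x ≤ γ := fun j => (hk j).trans hγ'.le
    exact (hlevel x γ hx (hbk.trans_lt hγ') hxγ).2.trans
      (le_csSup ⟨L, hupper⟩ ⟨γ, hbk.trans_lt hγ', ⟨x, hx, hxγ⟩, rfl⟩)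
  · obtain ⟨x, hx⟩ := hne
    obtain ⟨k, hk⟩ := Finite.exists_max fun k => b k x
    have hbk := hb k x
    exact csSup_le ⟨_, b k x + 1, by positivity,
      ⟨x, hx, fun j => (hk j).trans (by simp)⟩, rfl⟩ hupper

/-- The Cauchy–Schwarz inequality for the dot product of complex vectors. -/
theorem norm_star_dotProduct_sq_le {n : Type*} [Fintype n] (v h : n → ℂ) :
    ‖star v ⬝ᵥ h‖ ^ 2 ≤ (∑ j, ‖v j‖ ^ 2) * ∑ j, ‖h j‖ ^ 2 := by
  have h1 : ‖star v ⬝ᵥ h‖ ≤ ∑ j, ‖v j‖ * ‖h j‖ :=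
    (norm_sum_le _ _).trans_eq (by simp)
  calc ‖star v ⬝ᵥ h‖ ^ 2 ≤ (∑ j, ‖v j‖ * ‖h j‖) ^ 2 := by gcongr
    _ ≤ _ := Finset.sum_mul_sq_le_sq_mul_sq _ _ _

/-- two-stage reformulation of problem (P1): the optimal value of
(P1) equals sup_{γe > 0} log₂((1 + g₁(γe))/(1 + γe)), where g₁(γe) is the
optimal value of (P1.1) (γe's for which the restricted feasible set is empty
contribute −∞ and are excluded from the outer supremum). -/
theorem stmt_12 (M K d : ℕ) (hM : 1 ≤ M) (hK : 1 ≤ K) (hd : 1 ≤ d)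
    (h : Fin M → ℂ) (g : Fin K → Fin M → ℂ)
    (σ0 : ℝ) (hσ0 : 0 < σ0) (σ : Fin K → ℝ) (hσ : ∀ k, 0 < σ k)
    (ζ : ℝ) (hζ0 : 0 < ζ) (hζ1 : ζ ≤ 1) (P : ℝ) (hP : 0 < P)
    (E : Fin K → ℝ) (hE : ∀ k, 0 ≤ E k)
    (SINR0 : (Fin M → ℂ) → (Fin d → Fin M → ℂ) → ℝ)
    (hSINR0 : ∀ v w, SINR0 v w =
      ‖star v ⬝ᵥ h‖ ^ 2 / (∑ i, ‖star (w i) ⬝ᵥ h‖ ^ 2 + σ0))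
    (SINRk : Fin K → (Fin M → ℂ) → (Fin d → Fin M → ℂ) → ℝ)
    (hSINRk : ∀ k v w, SINRk k v w =
      ‖star v ⬝ᵥ g k‖ ^ 2 / (∑ i, ‖star (w i) ⬝ᵥ g k‖ ^ 2 + σ k))
    (r0 : (Fin M → ℂ) → (Fin d → Fin M → ℂ) → ℝ)
    (hr0 : ∀ v w, r0 v w = ⨅ k : Fin K,
      (Real.logb 2 (1 + SINR0 v w) - Real.logb 2 (1 + SINRk k v w)))
    (Feas : (Fin M → ℂ) → (Fin d → Fin M → ℂ) → Prop)
    (hFeas : ∀ v w, Feas v w ↔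
      (∀ k, ζ * (‖star v ⬝ᵥ g k‖ ^ 2 + ∑ i, ‖star (w i) ⬝ᵥ g k‖ ^ 2) ≥ E k) ∧
      (∑ j, ‖v j‖ ^ 2) + ∑ i, ∑ j, ‖w i j‖ ^ 2 ≤ P)
    (hne : ∃ v w, Feas v w)
    (g1 : ℝ → ℝ)
    (hg1 : ∀ γe, g1 γe = sSup {s : ℝ | ∃ v w, Feas v w ∧
      (∀ k, SINRk k v w ≤ γe) ∧ s = SINR0 v w}) :
    sSup {r : ℝ | ∃ v w, Feas v w ∧ r = r0 v w} =
    sSup {r : ℝ | ∃ γe : ℝ, 0 < γe ∧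
      (∃ v w, Feas v w ∧ ∀ k, SINRk k v w ≤ γe) ∧
      r = Real.logb 2 ((1 + g1 γe) / (1 + γe))} := by
  have : Nonempty (Fin K) := ⟨⟨0, hK⟩⟩
  have key := sSup_iInf_logb_sub_eq_sSup_level
    (X := (Fin M → ℂ) × (Fin d → Fin M → ℂ)) (fun x => Feas x.1 x.2)
    (fun x => SINR0 x.1 x.2) (fun k x => SINRk k x.1 x.2)
    (fun x => by rw [hSINR0]; positivity)
    (fun k x => by have := hσ k; rw [hSINRk]; positivity)
    (P * (∑ j, ‖h j‖ ^ 2) / σ0) (fun x hx => ?_) (by simpa using hne)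
  · simpa only [Prod.exists, ← hr0, ← hg1] using key
  · have hpow := ((hFeas _ _).1 hx).2
    have hv : ∑ j, ‖x.1 j‖ ^ 2 ≤ P :=
      (le_add_of_nonneg_right (by positivity)).trans hpow
    rw [hSINR0]
    gcongr
    · exact (norm_star_dotProduct_sq_le _ _).trans (by gcongr)
    · exact le_add_of_nonneg_left (by positivity)
end

section
/- (Two-stage reformulation of problem (P2).) Assume the feasible set of problem (P2) is nonempty. For γ₀ > 0, let g₂(γ₀) denote the supremum of the weighted sum-energy Σ_{k=1}^K μ_k ζ (|v₀ᴴ g_k|² + Σ_{i=1}^d |w_iᴴ g_k|²) over all (v₀, w_1,…,w_d) with ‖v₀‖² + Σ_i ‖w_i‖² ≤ P̄, SINR₀ ≥ γ₀, and SINR_k ≤ (1+γ₀)/2^{r̄₀} − 1 for every k = 1,…,K (the supremum of the empty set being taken as −∞). Then the optimal value of (P2) equals sup_{γ₀ > 0} g₂(γ₀). -/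
open Matrix Finset
open scoped ComplexOrder

theorem csSup_iUnion_eq_csSup_csSup {ι : Type*} (S : ι → Set ℝ) (hne : (⋃ i, S i).Nonempty)
    (hbdd : BddAbove (⋃ i, S i)) :
    sSup (⋃ i, S i) = sSup {e | ∃ i, (S i).Nonempty ∧ e = sSup (S i)} := by
  obtain ⟨x, hx⟩ := hne
  obtain ⟨i, hi⟩ := Set.mem_iUnion.1 hx
  have hle : ∀ e ∈ {e | ∃ i, (S i).Nonempty ∧ e = sSup (S i)}, e ≤ sSup (⋃ i, S i) := by
    rintro e ⟨j, hj, rfl⟩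
    exact csSup_le_csSup hbdd hj (Set.subset_iUnion S j)
  refine le_antisymm (csSup_le ⟨x, hx⟩ fun y hy => ?_) (csSup_le ⟨_, i, ⟨x, hi⟩, rfl⟩ hle)
  obtain ⟨j, hj⟩ := Set.mem_iUnion.1 hy
  exact (le_csSup (hbdd.mono (Set.subset_iUnion S j)) hj).trans
    (le_csSup ⟨_, hle⟩ ⟨j, ⟨y, hj⟩, rfl⟩)

theorem norm_star_dotProduct_sq_le_s13 {M : ℕ} (x y : Fin M → ℂ) :
    ‖star x ⬝ᵥ y‖ ^ 2 ≤ (∑ j, ‖x j‖ ^ 2) * ∑ j, ‖y j‖ ^ 2 := by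
  have hle : ‖star x ⬝ᵥ y‖ ≤ ∑ j, ‖x j‖ * ‖y j‖ := by
    refine (norm_sum_le _ _).trans (le_of_eq ?_)
    simp
  exact (pow_le_pow_left₀ (norm_nonneg _) hle 2).trans (sum_mul_sq_le_sq_mul_sq _ _ _)

theorem le_logb_two_sub_logb_two_iff {r a b : ℝ} (ha : 0 ≤ a) (hb : 0 ≤ b) :
    r ≤ Real.logb 2 (1 + a) - Real.logb 2 (1 + b) ↔ b ≤ (1 + a) / (2 : ℝ) ^ r - 1 := by
  rw [← Real.logb_div (by positivity) (by positivity),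
    Real.le_logb_iff_rpow_le (by norm_num) (by positivity), le_div_iff₀ (by positivity),
    le_sub_iff_add_le, le_div_iff₀ (by positivity), mul_comm, add_comm b]

/-- two-stage reformulation of problem (P2): the optimal value of
(P2) equals sup_{γ₀ > 0} g₂(γ₀), where g₂(γ₀) is the optimal value of (P2.1)
(γ₀'s for which the restricted feasible set is empty contribute −∞ and are
excluded from the outer supremum). -/
theorem stmt_13 (M K d : ℕ) (hM : 1 ≤ M) (hK : 1 ≤ K) (hd : 1 ≤ d)
    (h : Fin M → ℂ) (g : Fin K → Fin M → ℂ)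
    (σ0 : ℝ) (hσ0 : 0 < σ0) (σ : Fin K → ℝ) (hσ : ∀ k, 0 < σ k)
    (ζ : ℝ) (hζ0 : 0 < ζ) (hζ1 : ζ ≤ 1) (P : ℝ) (hP : 0 < P)
    (μ : Fin K → ℝ) (hμ : ∀ k, 0 ≤ μ k) (rbar0 : ℝ) (hrbar0 : 0 < rbar0)
    (SINR0 : (Fin M → ℂ) → (Fin d → Fin M → ℂ) → ℝ)
    (hSINR0 : ∀ v w, SINR0 v w =
      ‖star v ⬝ᵥ h‖ ^ 2 / (∑ i, ‖star (w i) ⬝ᵥ h‖ ^ 2 + σ0))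
    (SINRk : Fin K → (Fin M → ℂ) → (Fin d → Fin M → ℂ) → ℝ)
    (hSINRk : ∀ k v w, SINRk k v w =
      ‖star v ⬝ᵥ g k‖ ^ 2 / (∑ i, ‖star (w i) ⬝ᵥ g k‖ ^ 2 + σ k))
    (r0 : (Fin M → ℂ) → (Fin d → Fin M → ℂ) → ℝ)
    (hr0 : ∀ v w, r0 v w = ⨅ k : Fin K,
      (Real.logb 2 (1 + SINR0 v w) - Real.logb 2 (1 + SINRk k v w)))
    (Energy : (Fin M → ℂ) → (Fin d → Fin M → ℂ) → ℝ)
    (hEnergy : ∀ v w, Energy v w =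
      ∑ k, μ k * ζ * (‖star v ⬝ᵥ g k‖ ^ 2 + ∑ i, ‖star (w i) ⬝ᵥ g k‖ ^ 2))
    (Pow : (Fin M → ℂ) → (Fin d → Fin M → ℂ) → Prop)
    (hPow : ∀ v w, Pow v w ↔ (∑ j, ‖v j‖ ^ 2) + ∑ i, ∑ j, ‖w i j‖ ^ 2 ≤ P)
    (hne : ∃ v w, r0 v w ≥ rbar0 ∧ Pow v w)
    (g2 : ℝ → ℝ)
    (hg2 : ∀ γ0, g2 γ0 = sSup {e : ℝ | ∃ v w, Pow v w ∧ SINR0 v w ≥ γ0 ∧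
      (∀ k, SINRk k v w ≤ (1 + γ0) / (2 : ℝ) ^ rbar0 - 1) ∧ e = Energy v w}) :
    sSup {e : ℝ | ∃ v w, r0 v w ≥ rbar0 ∧ Pow v w ∧ e = Energy v w} =
    sSup {e : ℝ | ∃ γ0 : ℝ, 0 < γ0 ∧
      (∃ v w, Pow v w ∧ SINR0 v w ≥ γ0 ∧
        ∀ k, SINRk k v w ≤ (1 + γ0) / (2 : ℝ) ^ rbar0 - 1) ∧
      e = g2 γ0} := by
  have : Nonempty (Fin K) := ⟨⟨0, hK⟩⟩
  have hS0 : ∀ v w, 0 ≤ SINR0 v w := fun v w => by rw [hSINR0]; positivity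
  have hSk : ∀ k v w, 0 ≤ SINRk k v w := fun k v w => by
    have := hσ k
    rw [hSINRk]; positivity
  have hrate : ∀ v w, r0 v w ≥ rbar0 ↔
      ∀ k, SINRk k v w ≤ (1 + SINR0 v w) / (2 : ℝ) ^ rbar0 - 1 := fun v w => by
    rw [hr0, ge_iff_le, le_ciInf_iff (Set.finite_range _).bddBelow]
    exact forall_congr' fun k => le_logb_two_sub_logb_two_iff (hS0 v w) (hSk k v w)
  have hpow : 1 < (2 : ℝ) ^ rbar0 := Real.one_lt_rpow (by norm_num) hrbar0
  have hEle : ∀ v w, Pow v w → Energy v w ≤ ∑ k, μ k * ζ * (P * ∑ j, ‖g k j‖ ^ 2) := by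
    intro v w hvw
    rw [hEnergy]
    refine sum_le_sum fun k _ => mul_le_mul_of_nonneg_left ?_ (mul_nonneg (hμ k) hζ0.le)
    refine (add_le_add (norm_star_dotProduct_sq_le_s13 _ _)
      (sum_le_sum fun i _ => norm_star_dotProduct_sq_le_s13 _ _)).trans ?_
    rw [← sum_mul, ← add_mul]
    exact mul_le_mul_of_nonneg_right ((hPow v w).1 hvw) (by positivity)
  let S : {γ : ℝ // 0 < γ} → Set ℝ := fun γ => {e : ℝ | ∃ v w, Pow v w ∧ SINR0 v w ≥ γ ∧
      (∀ k, SINRk k v w ≤ (1 + γ) / (2 : ℝ) ^ rbar0 - 1) ∧ e = Energy v w}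
  have hunion : {e : ℝ | ∃ v w, r0 v w ≥ rbar0 ∧ Pow v w ∧ e = Energy v w} = ⋃ γ, S γ := by
    ext e
    rw [Set.mem_iUnion]
    constructor
    · rintro ⟨v, w, hr, hp, he⟩
      have hk := (hrate v w).1 hr
      have hpos : 0 < SINR0 v w := by
        have h1 := (hSk ⟨0, hK⟩ v w).trans (hk ⟨0, hK⟩)
        rw [sub_nonneg, one_le_div (by positivity)] at h1
        linarith
      exact ⟨⟨_, hpos⟩, v, w, hp, le_rfl, hk, he⟩
    · rintro ⟨γ, v, w, hp, hγ, hk, he⟩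
      refine ⟨v, w, (hrate v w).2 fun k => (hk k).trans ?_, hp, he⟩
      gcongr
  rw [hunion, csSup_iUnion_eq_csSup_csSup]
  · congr 1
    ext e
    constructor
    · rintro ⟨γ, ⟨_, v, w, hp, hγ, hk, _⟩, he⟩
      exact ⟨γ, γ.2, ⟨v, w, hp, hγ, hk⟩, he.trans (hg2 γ).symm⟩
    · rintro ⟨γ, hpos, ⟨v, w, hp, hγ, hk⟩, he⟩
      exact ⟨⟨γ, hpos⟩, ⟨_, v, w, hp, hγ, hk, rfl⟩, he.trans (hg2 γ)⟩
  · obtain ⟨v, w, hr, hp⟩ := hne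
    rw [← hunion]
    exact ⟨_, v, w, hr, hp, rfl⟩
  · rw [← hunion]
    refine ⟨∑ k, μ k * ζ * (P * ∑ j, ‖g k j‖ ^ 2), ?_⟩
    rintro e ⟨v, w, _, hp, rfl⟩
    exact hEle v w hp
end
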